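/- Let d ≥ 2, let k be an algebraically closed field of characteristic 0 or greater than d, and let n ≥ d+4. Let p_1,…,p_n ∈ k^{d+1} be nonzero vectors in general linear position, i.e. every subset of d+1 of them is linearly independent. If ψ_{I,J}(p) = 0 for every J ⊆ {1,…,n} with |J| = d+4 and every 6-element subset I ⊆ J, then p_1,…,p_n lie on a rational normal curve: there exist an invertible (d+1)×(d+1) matrix g over k, pairs (c_i,e_i) ∈ k²∖{(0,0)}, and nonzero scalars λ_i with p_i = λ_i · g·ν_d(c_i,e_i) for all i = 1,…,n. -/

import Mathlib

open Finset

/-- The standard rational normal curve of degree `d`. -/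
def nu (k : Type*) [CommRing k] (d : ℕ) (a b : k) : Fin (d + 1) → k :=
  fun i => (d.choose i.val : k) * a ^ (d - i.val) * b ^ i.val

/-- The bracket `|x y z t₁ … t_{d-2}|`. -/
def bracket {k : Type*} [CommRing k] (d n : ℕ) (p : Fin n → Fin (d + 1) → k)
    (x y z : Fin n) (t : Fin (d - 2) → Fin n) : k :=
  Matrix.det (Matrix.of fun (r c : Fin (d + 1)) =>
    if h : c.val < 3 then
      (if c.val = 0 then p x r else if c.val = 1 then p y r else p z r)
    else p (t ⟨c.val - 3, by have := c.isLt; omega⟩) r)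

/-- The equation `ψ_{I,J}` of `W_{d,n}`, where `i 0 < … < i 5` enumerate `I` and
`t 0 < … < t (d-3)` enumerate `J ∖ I`. -/
def psi {k : Type*} [CommRing k] (d n : ℕ) (p : Fin n → Fin (d + 1) → k)
    (i : Fin 6 → Fin n) (t : Fin (d - 2) → Fin n) : k :=
  bracket d n p (i 3) (i 4) (i 5) t * bracket d n p (i 1) (i 2) (i 5) t *
      bracket d n p (i 0) (i 2) (i 4) t * bracket d n p (i 0) (i 1) (i 3) t -
    bracket d n p (i 2) (i 4) (i 5) t * bracket d n p (i 1) (i 3) (i 5) t *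
      bracket d n p (i 0) (i 3) (i 4) t * bracket d n p (i 0) (i 1) (i 2) t

/-- Homogeneous expansion of a product of binary linear forms. -/
lemma prod_linear_forms_eq_sum {ι k : Type*} [DecidableEq ι] [CommRing k] (S : Finset ι)
    (u v : ι → k) (α β : k) :
    ∏ b ∈ S, (α * u b + β * v b) = ∑ j ∈ range (S.card + 1),
      (∑ t ∈ powersetCard j S, (∏ b ∈ t, v b) * ∏ b ∈ S \ t, u b) * (α ^ (S.card - j) * β ^ j) := by
  simp_rw [add_comm (α * _)]
  rw [Finset.prod_add, Finset.sum_powerset]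
  refine Finset.sum_congr rfl fun j _ => ?_
  rw [Finset.sum_mul]
  refine Finset.sum_congr rfl fun t ht => ?_
  obtain ⟨hts, htc⟩ := Finset.mem_powersetCard.1 ht
  rw [Finset.prod_mul_distrib, Finset.prod_mul_distrib, Finset.prod_const, Finset.prod_const,
    Finset.card_sdiff_of_subset hts, htc]
  ring

lemma natCast_choose_ne_zero {k : Type*} [Field k] {d i : ℕ}
    (hchar : ringChar k = 0 ∨ d < ringChar k) (hi : i ≤ d) : (d.choose i : k) ≠ 0 := by
  have hpos : d.choose i ≠ 0 := (Nat.choose_pos hi).ne'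
  intro h
  have hdvd := (ringChar.spec k _).1 h
  rcases hchar with h0 | hlt
  · rw [h0, zero_dvd_iff] at hdvd
    exact hpos hdvd
  · have hp : (ringChar k).Prime :=
      (CharP.char_is_prime_or_zero k (ringChar k)).resolve_right (by omega)
    have hfac : d.choose i ∣ d.factorial :=
      ⟨i.factorial * (d - i).factorial, by rw [← mul_assoc, Nat.choose_mul_factorial_mul_factorial hi]⟩
    exact absurd ((hp.dvd_factorial).1 (hdvd.trans hfac)) (by omega)

/-- The forms `∏_{b ≠ a} (α u_b + β v_b)` are linear images of the standard rational normal
curve. -/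
lemma exists_mulVec_nu_eq_prod {k : Type*} [Field k] {d : ℕ}
    (hchar : ringChar k = 0 ∨ d < ringChar k) (u v : Fin (d + 1) → k) :
    ∃ G : Matrix (Fin (d + 1)) (Fin (d + 1)) k, ∀ α β a,
      G.mulVec (nu k d α β) a = ∏ b ∈ univ.erase a, (α * u b + β * v b) := by
  refine ⟨Matrix.of fun a i => (∑ t ∈ powersetCard i.val (univ.erase a),
    (∏ b ∈ t, v b) * ∏ b ∈ univ.erase a \ t, u b) / (d.choose i.val : k), fun α β a => ?_⟩
  have hcard : (univ.erase a).card = d := by simp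
  rw [prod_linear_forms_eq_sum, hcard, Finset.sum_range]
  simp only [Matrix.mulVec, dotProduct]
  refine Finset.sum_congr rfl fun i _ => ?_
  have := natCast_choose_ne_zero (k := k) hchar (Nat.lt_succ_iff.1 i.isLt)
  simp only [Matrix.of_apply, nu]
  field_simp

lemma bracket_mulVec {k : Type*} [CommRing k] (d n : ℕ) (P : Matrix (Fin (d + 1)) (Fin (d + 1)) k)
    (q : Fin n → Fin (d + 1) → k) (x y z : Fin n) (t : Fin (d - 2) → Fin n) :
    bracket d n (fun i => P.mulVec (q i)) x y z t = P.det * bracket d n q x y z t := by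
  unfold bracket
  rw [← Matrix.det_mul]
  congr 1
  ext r c
  simp only [Matrix.mul_apply, Matrix.of_apply]
  split_ifs <;> rfl

lemma psi_mulVec {k : Type*} [CommRing k] (d n : ℕ) (P : Matrix (Fin (d + 1)) (Fin (d + 1)) k)
    (q : Fin n → Fin (d + 1) → k) (i : Fin 6 → Fin n) (t : Fin (d - 2) → Fin n) :
    psi d n (fun i => P.mulVec (q i)) i t = P.det ^ 4 * psi d n q i t := by
  simp only [psi, bracket_mulVec]
  ring

/-- Brackets whose last columns are distinct standard basis vectors are, up to a common sign,
`3 × 3` minors. -/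
lemma exists_bracket_eq_mul_det {k : Type*} [Field k] {d n : ℕ} (hd : 2 ≤ d)
    (q : Fin n → Fin (d + 1) → k) (t : Fin (d - 2) → Fin n)
    (σ : Fin 3 ⊕ Fin (d - 2) ≃ Fin (d + 1))
    (ht : ∀ j, q (t j) = Pi.single (σ (Sum.inr j)) 1) :
    ∃ s : k, s ≠ 0 ∧ ∀ x y z, bracket d n q x y z t =
      s * (Matrix.of fun r c : Fin 3 => q (![x, y, z] c) (σ (Sum.inl r))).det := by
  let τ : Fin 3 ⊕ Fin (d - 2) ≃ Fin (d + 1) :=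
    finSumFinEquiv.trans (finCongr (by omega))
  let π : Equiv.Perm (Fin (d + 1)) := τ.symm.trans σ
  refine ⟨((Equiv.Perm.sign π : ℤ) : k), ?_, fun x y z => ?_⟩
  · rcases Int.units_eq_one_or (Equiv.Perm.sign π) with h | h <;> simp [h]
  · have hsq : ((Equiv.Perm.sign π : ℤ) : k) * ((Equiv.Perm.sign π : ℤ) : k) = 1 := by
      rcases Int.units_eq_one_or (Equiv.Perm.sign π) with h | h <;> simp [h]
    unfold bracket
    set M : Matrix (Fin (d + 1)) (Fin (d + 1)) k := Matrix.of _ with hM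
    have h1 : (M.submatrix σ τ).det = ((Equiv.Perm.sign π : ℤ) : k) * M.det := by
      rw [← Matrix.det_permute π M, ← Matrix.det_submatrix_equiv_self τ]
      congr 1
      ext r c
      simp [π]
    have h2 : M.submatrix σ τ = Matrix.fromBlocks
        (Matrix.of fun r c : Fin 3 => q (![x, y, z] c) (σ (Sum.inl r))) 0
        (Matrix.of fun r c => q (![x, y, z] c) (σ (Sum.inr r))) 1 := by
      have hl : ∀ c : Fin 3, (τ (Sum.inl c)).val = c.val := fun c => by simp [τ]
      have hr : ∀ c : Fin (d - 2), (τ (Sum.inr c)).val = 3 + c.val := fun c => by simp [τ]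
      ext r c
      rcases c with c | c
      · have : M (σ r) (τ (Sum.inl c)) = q (![x, y, z] c) (σ r) := by
          simp only [hM, Matrix.of_apply, hl]
          fin_cases c <;> simp
        rcases r with r | r <;> simpa using this
      · have : M (σ r) (τ (Sum.inr c)) = q (t c) (σ r) := by
          simp [hM, hr]
        rw [Matrix.submatrix_apply, this, ht]
        rcases r with r | r <;> simp [Pi.single_apply, Matrix.one_apply]
    rw [h2, Matrix.det_fromBlocks_zero₁₂, Matrix.det_one, mul_one] at h1
    rw [h1, ← mul_assoc, hsq, one_mul]

/-- If three of the six points of `ψ` are standard basis vectors, the coordinatewise inverses of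
the other three points have vanishing `3 × 3` minor in the corresponding coordinates. -/
lemma inv_minor_eq_zero {k : Type*} [Field k] {d n : ℕ} (hd : 2 ≤ d)
    (q : Fin n → Fin (d + 1) → k) (f : Fin (d + 1) → Fin n) (hf : StrictMono f)
    (hq : ∀ c, q (f c) = Pi.single c 1)
    (hpsi : ∀ (i : Fin 6 → Fin n) (t : Fin (d - 2) → Fin n),
      StrictMono i → StrictMono t → (∀ x y, i x ≠ t y) → psi d n q i t = 0)
    {a b c : Fin (d + 1)} (hab : a < b) (hbc : b < c) {x y z : Fin n} (hx : ∀ c, f c < x)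
    (hxy : x < y) (hyz : y < z) (hnz : ∀ w, x ≤ w → ∀ r, q w r ≠ 0) :
    (!![(q x a)⁻¹, (q x b)⁻¹, (q x c)⁻¹; (q y a)⁻¹, (q y b)⁻¹, (q y c)⁻¹;
      (q z a)⁻¹, (q z b)⁻¹, (q z c)⁻¹]).det = 0 := by
  have hac := hab.trans hbc
  have hcard : (({a, b, c} : Finset (Fin (d + 1)))ᶜ).card = d - 2 := by
    rw [Finset.card_compl, Fintype.card_fin, Finset.card_eq_three.2
      ⟨a, b, c, hab.ne, hac.ne, hbc.ne, rfl⟩]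
    omega
  let s := ({a, b, c} : Finset (Fin (d + 1)))ᶜ.orderEmbOfFin hcard
  have hs : ∀ j, s j ≠ a ∧ s j ≠ b ∧ s j ≠ c := fun j => by
    have := Finset.orderEmbOfFin_mem ({a, b, c} : Finset (Fin (d + 1)))ᶜ hcard j
    simpa only [Finset.mem_compl, Finset.mem_insert, Finset.mem_singleton, not_or] using this
  have habc : StrictMono ![a, b, c] := by
    rw [Fin.strictMono_iff_lt_succ]
    intro i
    fin_cases i
    exacts [hab, hbc]
  have hinj : Function.Injective (Sum.elim ![a, b, c] s) :=
    habc.injective.sumElim s.injective fun i j h => by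
      obtain ⟨h1, h2, h3⟩ := hs j
      fin_cases i
      exacts [h1 h.symm, h2 h.symm, h3 h.symm]
  let σ : Fin 3 ⊕ Fin (d - 2) ≃ Fin (d + 1) := Equiv.ofBijective _
    ((Fintype.bijective_iff_injective_and_card _).2 ⟨hinj, by simp; omega⟩)
  obtain ⟨ε, hε, hbr⟩ := exists_bracket_eq_mul_det hd q (f ∘ s) σ fun j => hq _
  have hmono : StrictMono ![f a, f b, f c, x, y, z] := by
    rw [Fin.strictMono_iff_lt_succ]
    intro i
    fin_cases i
    exacts [hf hab, hf hbc, hx c, hxy, hyz]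
  have key := hpsi _ (f ∘ s) hmono (hf.comp s.strictMono) fun i j h => by
    obtain ⟨h1, h2, h3⟩ := hs j
    fin_cases i
    exacts [h1 (hf.injective h.symm), h2 (hf.injective h.symm), h3 (hf.injective h.symm),
      (hx (s j)).ne h.symm, ((hx (s j)).trans hxy).ne h.symm,
      ((hx (s j)).trans (hxy.trans hyz)).ne h.symm]
  have hσ0 : σ (Sum.inl 0) = a := rfl
  have hσ1 : σ (Sum.inl 1) = b := rfl
  have hσ2 : σ (Sum.inl 2) = c := rfl
  have e3 : (![f a, f b, f c, x, y, z] : Fin 6 → Fin n) 3 = x := rfl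
  have e4 : (![f a, f b, f c, x, y, z] : Fin 6 → Fin n) 4 = y := rfl
  have e5 : (![f a, f b, f c, x, y, z] : Fin 6 → Fin n) 5 = z := rfl
  have e2 : (![f a, f b, f c, x, y, z] : Fin 6 → Fin n) 2 = f c := rfl
  simp only [psi, hbr, e2, e3, e4, e5, Matrix.cons_val_zero, Matrix.cons_val_one, Matrix.of_apply,
    Matrix.det_fin_three, hσ0, hσ1, hσ2, Matrix.cons_val_two, Matrix.tail_cons, Matrix.head_cons,
    hq, Pi.single_apply,
    hab.ne, hab.ne', hac.ne, hac.ne', hbc.ne, hbc.ne', if_true, if_false] at key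
  have key2 : ε ^ 4 * ((q y a * q z b - q y b * q z a) * (q x a * q z c - q x c * q z a) *
      (q x b * q y c - q x c * q y b) - (q x a * (q y b * q z c - q y c * q z b) -
      q y a * (q x b * q z c - q x c * q z b) + q z a * (q x b * q y c - q x c * q y b)) *
      q z a * q y b * q x c) = 0 := by
    linear_combination key
  have key3 := (mul_eq_zero.1 key2).resolve_left (pow_ne_zero 4 hε)
  have nx := hnz x le_rfl
  have ny := hnz y hxy.le
  have nz := hnz z (hxy.trans hyz).le
  have nxa := nx a
  have nxb := nx b
  have nxc := nx c
  have nya := ny a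
  have nyb := ny b
  have nyc := ny c
  have nza := nz a
  have nzb := nz b
  have nzc := nz c
  simp only [Matrix.det_fin_three, Matrix.of_apply, Matrix.cons_val_zero, Matrix.cons_val_one,
    Matrix.cons_val]
  field_simp
  linear_combination -key3

/-- A linear form vanishing on a basis family of vectors is zero. -/
lemma linearMap_eq_zero_of_linearIndependent {ι k : Type*} [Field k] {m : ℕ} {p : ι → Fin m → k}
    {s : Finset ι} (hs : s.card = m) (hp : LinearIndependent k (fun i : {x // x ∈ s} => p i.1))
    (φ : (Fin m → k) →ₗ[k] k) (hφ : ∀ i ∈ s, φ (p i) = 0) : φ = 0 := by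
  have hspan : Submodule.span k (Set.range fun i : {x // x ∈ s} => p i.1) = ⊤ :=
    hp.span_eq_top_of_card_eq_finrank' (by simp [hs])
  refine LinearMap.ext_on_range hspan fun i => ?_
  simpa using hφ i i.2

/-- Points containing the coordinate simplex, in general linear position and satisfying the
equations `ψ`, lie on a rational normal curve. -/
lemma exists_rnc_of_basis {k : Type*} [Field k] {d n : ℕ} (hd : 2 ≤ d) (hn : d + 4 ≤ n)
    (hchar : ringChar k = 0 ∨ d < ringChar k) (q : Fin n → Fin (d + 1) → k)
    (hq : ∀ c : Fin (d + 1), q (c.castLE (by omega)) = Pi.single c 1)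
    (hglp : ∀ s : Finset (Fin n), s.card = d + 1 →
      LinearIndependent k (fun i : {x // x ∈ s} => q i.1))
    (hpsi : ∀ (i : Fin 6 → Fin n) (t : Fin (d - 2) → Fin n),
      StrictMono i → StrictMono t → (∀ x y, i x ≠ t y) → psi d n q i t = 0) :
    ∃ (g : Matrix (Fin (d + 1)) (Fin (d + 1)) k) (c e lam : Fin n → k),
      IsUnit g ∧ (∀ i, (c i, e i) ≠ (0, 0)) ∧ (∀ i, lam i ≠ 0) ∧
      ∀ i, q i = lam i • g.mulVec (nu k d (c i) (e i)) := by
  have hdn : d + 1 ≤ n := by omega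
  let f : Fin (d + 1) → Fin n := Fin.castLE hdn
  have hfinj : Function.Injective f := Fin.castLE_injective hdn
  have hqf : ∀ c, q (f c) = Pi.single c 1 := hq
  have hnotin : ∀ w : Fin n, d + 1 ≤ w.val → ∀ S : Finset (Fin (d + 1)), w ∉ S.image f := by
    intro w hw S hmem
    obtain ⟨c, -, rfl⟩ := Finset.mem_image.1 hmem
    exact absurd c.isLt (not_lt.2 hw)
  have hnz : ∀ w : Fin n, d + 1 ≤ w.val → ∀ a, q w a ≠ 0 := by
    intro w hw a h0
    have hcard : (insert w ((univ.erase a).image f)).card = d + 1 := by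
      rw [Finset.card_insert_of_notMem (hnotin w hw _), Finset.card_image_of_injective _ hfinj]
      simp
    have := linearMap_eq_zero_of_linearIndependent hcard (hglp _ hcard) (LinearMap.proj a) (by
      simp only [Finset.mem_insert, Finset.mem_image, Finset.mem_erase, Finset.mem_univ, and_true]
      rintro i (rfl | ⟨c, hc, rfl⟩)
      · exact h0
      · simp [hqf, hc.symm])
    simpa using LinearMap.congr_fun this (Pi.single a 1)
  let x : Fin n := ⟨d + 1, by omega⟩
  let y : Fin n := ⟨d + 2, by omega⟩
  have hxy : x < y := Fin.mk_lt_mk.2 (by omega)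
  have hx0 := hnz x le_rfl
  have hy0 := hnz y (by simp [y])
  have hminor : ∀ a b, a ≠ b → q x b * q y a - q x a * q y b ≠ 0 := by
    intro a b hab h0
    have hycard : (insert y (((univ.erase a).erase b).image f)).card = d := by
      rw [Finset.card_insert_of_notMem (hnotin y (by simp [y]) _),
        Finset.card_image_of_injective _ hfinj, Finset.card_erase_of_mem (by simp [hab.symm]),
        Finset.card_erase_of_mem (by simp), Finset.card_univ, Fintype.card_fin]
      omega
    have hcard : (insert x (insert y (((univ.erase a).erase b).image f))).card = d + 1 := by
      rw [Finset.card_insert_of_notMem, hycard]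
      rw [Finset.mem_insert, not_or]
      exact ⟨hxy.ne, hnotin x le_rfl _⟩
    have := linearMap_eq_zero_of_linearIndependent hcard (hglp _ hcard)
      (q x b • LinearMap.proj a - q x a • LinearMap.proj b) (by
        simp only [Finset.mem_insert, Finset.mem_image, Finset.mem_erase, Finset.mem_univ,
          and_true]
        rintro i (rfl | rfl | ⟨c, ⟨hcb, hca⟩, rfl⟩)
        · simp [mul_comm]
        · simpa using h0
        · simp [hqf, hcb.symm, hca.symm])
    have h1 := LinearMap.congr_fun this (Pi.single a 1)
    simp [hab.symm, hx0] at h1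
  let u : Fin (d + 1) → k := fun a => (q x a)⁻¹
  let v : Fin (d + 1) → k := fun a => (q y a)⁻¹
  have huv : ∀ a b, a ≠ b → v a * u b - u a * v b ≠ 0 := by
    intro a b hab h0
    apply hminor a b hab
    have h1 := hx0 a
    have h2 := hx0 b
    have h3 := hy0 a
    have h4 := hy0 b
    simp only [u, v] at h0
    field_simp at h0
    linear_combination -h0
  have hline : ∀ w : Fin n, d + 1 ≤ w.val →
      ∃ α β : k, ∀ a, (q w a)⁻¹ = α * u a + β * v a := by
    intro w hw
    by_cases hwx : w = x
    · exact ⟨1, 0, fun a => by simp [hwx, u]⟩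
    by_cases hwy : w = y
    · exact ⟨0, 1, fun a => by simp [hwy, v]⟩
    have hyw : y < w := by
      rw [Fin.lt_def]
      rw [Fin.ext_iff] at hwx hwy
      simp only [x, y] at hwx hwy ⊢
      omega
    let o : Fin (d + 1) := ⟨1, by omega⟩
    have hlt : (0 : Fin (d + 1)) < o := Fin.mk_lt_mk.2 one_pos
    have hD := huv 0 o hlt.ne
    refine ⟨(v 0 * (q w o)⁻¹ - v o * (q w 0)⁻¹) / (v 0 * u o - u 0 * v o),
      (u o * (q w 0)⁻¹ - u 0 * (q w o)⁻¹) / (v 0 * u o - u 0 * v o), fun a => ?_⟩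
    rw [div_mul_eq_mul_div, div_mul_eq_mul_div, ← add_div, eq_div_iff hD]
    by_cases ha0 : a = 0
    · rw [ha0]
      ring
    by_cases ha1 : a = o
    · rw [ha1]
      ring
    have hoa : o < a := by
      rw [Fin.lt_def]
      rw [Fin.ext_iff] at ha0 ha1
      simp only [o, Fin.val_zero] at ha0 ha1 ⊢
      omega
    have hdet := inv_minor_eq_zero hd q f (Fin.strictMono_castLE hdn) hqf hpsi hlt hoa
      (x := x)
      (fun c => Fin.lt_def.2 c.isLt) hxy hyw fun w' hw' => hnz w' (Fin.le_def.1 hw')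
    simp only [Matrix.det_fin_three, Matrix.of_apply, Matrix.cons_val_zero, Matrix.cons_val_one,
      Matrix.cons_val] at hdet
    simp only [u, v]
    linear_combination -hdet
  obtain ⟨G, hG⟩ := exists_mulVec_nu_eq_prod hchar u v
  have hpt : ∀ w : Fin n, ∃ c e lam : k, (c, e) ≠ (0, 0) ∧ lam ≠ 0 ∧
      q w = lam • G.mulVec (nu k d c e) := by
    intro w
    rcases lt_or_ge w.val (d + 1) with hw | hw
    · obtain ⟨a, rfl⟩ : ∃ a, w = f a := ⟨⟨w, hw⟩, rfl⟩
      have hne : ∏ b ∈ univ.erase a, (v a * u b + -u a * v b) ≠ 0 := by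
        refine Finset.prod_ne_zero_iff.2 fun b hb => ?_
        rw [neg_mul, ← sub_eq_add_neg]
        exact huv a b (Finset.ne_of_mem_erase hb).symm
      refine ⟨v a, -u a, (∏ b ∈ univ.erase a, (v a * u b + -u a * v b))⁻¹, ?_, inv_ne_zero hne, ?_⟩
      · simp [v, hy0]
      · ext b
        rw [Pi.smul_apply, hG, hqf, smul_eq_mul]
        by_cases hba : b = a
        · rw [hba, Pi.single_eq_same, inv_mul_cancel₀ hne]
        · rw [Pi.single_eq_of_ne hba, Finset.prod_eq_zero (i := a) (s := univ.erase b), mul_zero]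
          · simp [Ne.symm hba]
          · ring
    · obtain ⟨α, β, hαβ⟩ := hline w hw
      have hL : ∀ a, α * u a + β * v a ≠ 0 := fun a => hαβ a ▸ inv_ne_zero (hnz w hw a)
      have hne : ∏ b, (α * u b + β * v b) ≠ 0 := Finset.prod_ne_zero_iff.2 fun b _ => hL b
      refine ⟨α, β, (∏ b, (α * u b + β * v b))⁻¹, ?_, inv_ne_zero hne, ?_⟩
      · intro h
        obtain ⟨rfl, rfl⟩ := Prod.mk.inj h
        exact hL 0 (by simp)
      · ext a
        rw [Pi.smul_apply, hG, smul_eq_mul, ← Finset.mul_prod_erase univ _ (Finset.mem_univ a),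
          mul_inv, mul_assoc, inv_mul_cancel₀, mul_one, ← hαβ, inv_inv]
        exact Finset.prod_ne_zero_iff.2 fun b _ => hL b
  choose c e lam hce hlam hqw using hpt
  refine ⟨G, c, e, lam, ?_, hce, hlam, hqw⟩
  refine IsUnit.of_mul_eq_one (b := (Matrix.of fun a b =>
    lam (f b) * nu k d (c (f b)) (e (f b)) a)) ?_
  ext a b
  have := congrFun (hqw (f b)) a
  rw [hqf, ← Matrix.mulVec_smul] at this
  rw [Matrix.one_apply, ← Pi.single_apply, this]
  rfl

/-- Linearly general points satisfying the equations of `W_{d,n}` lie on a rational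
normal curve. -/
theorem glp_points_satisfying_psi_lie_on_rnc (d n : ℕ) (hd : 2 ≤ d) (hn : d + 4 ≤ n)
    (k : Type*) [Field k] [IsAlgClosed k]
    (hchar : ringChar k = 0 ∨ d < ringChar k)
    (p : Fin n → Fin (d + 1) → k) (hne : ∀ i, p i ≠ 0)
    (hglp : ∀ s : Finset (Fin n), s.card = d + 1 →
      LinearIndependent k (fun i : {x // x ∈ s} => p i.1))
    (hpsi : ∀ (i : Fin 6 → Fin n) (t : Fin (d - 2) → Fin n),
      StrictMono i → StrictMono t → (∀ x y, i x ≠ t y) → psi d n p i t = 0) :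
    ∃ (g : Matrix (Fin (d + 1)) (Fin (d + 1)) k) (c e lam : Fin n → k),
      IsUnit g ∧ (∀ i, (c i, e i) ≠ (0, 0)) ∧ (∀ i, lam i ≠ 0) ∧
      ∀ i, p i = lam i • g.mulVec (nu k d (c i) (e i)) := by
  have hdn : d + 1 ≤ n := by omega
  let P : Matrix (Fin (d + 1)) (Fin (d + 1)) k := Matrix.of fun r c => p (c.castLE hdn) r
  have hP : IsUnit P := by
    rw [← Matrix.linearIndependent_cols_iff_isUnit]
    let s : Finset (Fin n) := univ.map (Fin.castLEEmb hdn)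
    have hs : s.card = d + 1 := by simp [s]
    exact (hglp s hs).comp (fun c => ⟨c.castLE hdn, Finset.mem_map_of_mem _ (Finset.mem_univ c)⟩)
      fun a b h => Fin.castLE_injective hdn (congrArg Subtype.val h)
  have hdet : IsUnit P.det := (Matrix.isUnit_iff_isUnit_det P).1 hP
  let q : Fin n → Fin (d + 1) → k := fun i => P⁻¹.mulVec (p i)
  have hpq : p = fun i => P.mulVec (q i) := by
    funext i
    simp [q, Matrix.mulVec_mulVec, Matrix.mul_nonsing_inv P hdet]
  obtain ⟨g, c, e, lam, hg, hce, hlam, hq⟩ := exists_rnc_of_basis hd hn hchar q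
    (fun c => by
      have : p (c.castLE hdn) = P.mulVec (Pi.single c 1) := by
        ext r
        simp [P]
      simp only [q]
      rw [this, Matrix.mulVec_mulVec, Matrix.nonsing_inv_mul P hdet, Matrix.one_mulVec])
    (fun s hs => by
      refine LinearIndependent.of_comp P.mulVecLin ?_
      have := hglp s hs
      rw [hpq] at this
      exact this)
    (fun i t hi ht hit => by
      have := hpsi i t hi ht hit
      rw [hpq, psi_mulVec] at this
      exact (mul_eq_zero.1 this).resolve_left (pow_ne_zero 4 hdet.ne_zero))
  refine ⟨P * g, c, e, lam, hP.mul hg, hce, hlam, fun i => ?_⟩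
  rw [← Matrix.mulVec_mulVec, ← Matrix.mulVec_smul, ← hq]
  exact congrFun hpq i
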